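/- For any u ∈ ℝ^N with some coordinate u(j) < 0 for j ∈ Z', and S, J_ls as in the Bayesian level-set model, if u ≠ 0 then for all ε ∈ (0,1), J_ls(εu) < J_ls(u) whenever ⟨u,Pu⟩ > 0; i.e., scaling down strictly decreases the level-set objective since the misfit term Φ_ls(u;y) = Σ_{j∈Z'}(1/(2γ²))|y(j)−S(u(j))|² is invariant under positive scaling of u. -/

import Mathlib

open Matrix BigOperators

theorem stmt_13 {N : ℕ} (P : Matrix (Fin N) (Fin N) ℝ)
    (hsym : P.IsSymm) (hpsd : ∀ u : Fin N → ℝ, 0 ≤ u ⬝ᵥ P.mulVec u)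
    (Z' : Finset (Fin N)) (y : Fin N → ℝ) (hy : ∀ j ∈ Z', y j = 1 ∨ y j = -1)
    (γ : ℝ) (hγ : 0 < γ)
    (S : ℝ → ℝ) (hS : ∀ u, S u = if 0 ≤ u then 1 else -1)
    (J : (Fin N → ℝ) → ℝ)
    (hJ : ∀ u, J u = (1 / 2) * (u ⬝ᵥ P.mulVec u) +
      ∑ j ∈ Z', (1 / (2 * γ ^ 2)) * |y j - S (u j)| ^ 2)
    (u : Fin N → ℝ) (hneg : ∃ j ∈ Z', u j < 0) (hu : u ≠ 0)
    (hquad : 0 < u ⬝ᵥ P.mulVec u) :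
    ∀ ε : ℝ, ε ∈ Set.Ioo (0 : ℝ) 1 → J (ε • u) < J u := by
  rintro ε ⟨hε₀, hε₁⟩
  have hsign : ∀ t : ℝ, S (ε * t) = S t := fun t => by
    simp only [hS, mul_nonneg_iff_of_pos_left hε₀]
  simp only [hJ, Pi.smul_apply, smul_eq_mul, hsign, Matrix.mulVec_smul, smul_dotProduct,
    dotProduct_smul]
  have hε : ε * ε < 1 := by nlinarith
  nlinarith [mul_lt_mul_of_pos_right hε hquad]
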